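/- arXiv:2006.15842 — 2 statements merged into one kernel-verified Lean document; each statement's English description precedes it below -/
import Mathlib

section
/- Let a be a nonnegative integer and let B = 2a+1. Then f(B) = 1 + (a²+3a+2)/√(4a²+12a+5), where f(B) = sup over θ ∈ S_B and over positive integers N of N·H(θ, N). -/
/-- The points `0, {θ}, {2θ}, …, {Nθ}, 1` used in the three-gap theorem. -/
def gapPoints (θ : ℝ) (N : ℕ) : Set ℝ :=
  insert 1 {x : ℝ | ∃ k : ℕ, k ≤ N ∧ x = Int.fract (k * θ)}

/-- The gap set `G(θ, N)`: the set of differences between consecutive points among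
`0, {θ}, {2θ}, …, {Nθ}, 1` sorted in ascending order. -/
def gapSet (θ : ℝ) (N : ℕ) : Set ℝ :=
  {d : ℝ | ∃ a ∈ gapPoints θ N, ∃ b ∈ gapPoints θ N,
    a < b ∧ (∀ c ∈ gapPoints θ N, ¬(a < c ∧ c < b)) ∧ d = b - a}

/-- `H(θ, N)`, the largest gap in the gap set `G(θ, N)`. -/
noncomputable def maxGap (θ : ℝ) (N : ℕ) : ℝ := sSup (gapSet θ N)

/-- `θ` has all partial quotients `a_i` (for `i ≥ 1`) of its simple continued fraction
expansion bounded by `B`.  (Index `i` of `partDens` corresponds to `a_{i+1}`.) -/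
def PartQuotBounded (θ : ℝ) (B : ℕ) : Prop :=
  ∀ i : ℕ, ∀ a ∈ ((GenContFract.of θ).partDens.get? i), a ≤ (B : ℝ)

/-- `S_B`: the set of irrational numbers in `(0,1)` with partial quotients bounded by `B`. -/
def SB (B : ℕ) : Set ℝ :=
  {θ : ℝ | Irrational θ ∧ θ ∈ Set.Ioo (0 : ℝ) 1 ∧ PartQuotBounded θ B}

/-- `f(B) = sup_{θ ∈ S_B} sup_{N ≥ 1} N · H(θ, N)`. -/
noncomputable def badF (B : ℕ) : ℝ :=
  sSup {x : ℝ | ∃ θ ∈ SB B, ∃ N : ℕ, 1 ≤ N ∧ x = (N : ℝ) * maxGap θ N}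

/-- The Gauss map `t ↦ {1 / t}`. -/
noncomputable def gaussMap (t : ℝ) : ℝ := Int.fract t⁻¹

/-- Irrational points of `(0, 1)` all of whose Gauss-map digits are at most `B`. -/
def boundedDigits (B : ℕ) : Set ℝ :=
  {t : ℝ | Irrational t ∧ t ∈ Set.Ioo (0 : ℝ) 1 ∧ ∀ n : ℕ, ⌊(gaussMap^[n] t)⁻¹⌋ ≤ (B : ℤ)}

lemma irrational_gaussMap {t : ℝ} (ht : Irrational t) : Irrational (gaussMap t) := by
  have h : gaussMap t = t⁻¹ - ((⌊t⁻¹⌋ : ℤ) : ℝ) := rfl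
  rw [h]
  exact ht.inv.sub_intCast _

lemma gaussMap_mem_Ioo {t : ℝ} (ht : Irrational t) : gaussMap t ∈ Set.Ioo (0 : ℝ) 1 :=
  ⟨lt_of_le_of_ne (Int.fract_nonneg _) (irrational_gaussMap ht).ne_zero.symm, Int.fract_lt_one _⟩

lemma irrational_gaussMap_iterate {t : ℝ} (ht : Irrational t) (n : ℕ) :
    Irrational (gaussMap^[n] t) := by
  induction n with
  | zero => exact ht
  | succ n ih =>
    rw [Function.iterate_succ_apply']
    exact irrational_gaussMap ih

lemma gaussMap_mem_boundedDigits {B : ℕ} {t : ℝ} (ht : t ∈ boundedDigits B) :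
    gaussMap t ∈ boundedDigits B :=
  ⟨irrational_gaussMap ht.1, gaussMap_mem_Ioo ht.1, fun n => by
    simpa only [Function.iterate_succ_apply] using ht.2.2 (n + 1)⟩

lemma exists_stream_eq_gaussMap_iterate {t : ℝ} (ht : Irrational t) (h : t ∈ Set.Ioo (0 : ℝ) 1)
    (n : ℕ) : ∃ b : ℤ, GenContFract.IntFractPair.stream t n = some ⟨b, gaussMap^[n] t⟩ := by
  induction n with
  | zero =>
    refine ⟨⌊t⌋, ?_⟩
    have : Int.fract t = t := Int.fract_eq_self.2 ⟨h.1.le, h.2⟩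
    simp [GenContFract.IntFractPair.stream, GenContFract.IntFractPair.of, this]
  | succ n ih =>
    obtain ⟨b, hb⟩ := ih
    refine ⟨⌊(gaussMap^[n] t)⁻¹⌋, ?_⟩
    rw [Function.iterate_succ_apply']
    exact GenContFract.IntFractPair.stream_succ_of_some hb
      (irrational_gaussMap_iterate ht n).ne_zero

lemma partDens_get?_eq {t : ℝ} (ht : Irrational t) (h : t ∈ Set.Ioo (0 : ℝ) 1) (n : ℕ) :
    (GenContFract.of t).partDens.get? n = some ((⌊(gaussMap^[n] t)⁻¹⌋ : ℤ) : ℝ) := by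
  obtain ⟨b, hb⟩ := exists_stream_eq_gaussMap_iterate ht h n
  have h1 := GenContFract.IntFractPair.stream_succ_of_some hb
    (irrational_gaussMap_iterate ht n).ne_zero
  have h2 := GenContFract.get?_of_eq_some_of_succ_get?_intFractPair_stream h1
  exact GenContFract.partDen_eq_s_b h2

lemma SB_eq_boundedDigits (B : ℕ) : SB B = boundedDigits B := by
  ext t
  constructor
  · rintro ⟨h1, h2, h3⟩
    refine ⟨h1, h2, fun n => ?_⟩
    have := h3 n _ (partDens_get?_eq h1 h2 n)
    exact_mod_cast this
  · rintro ⟨h1, h2, h3⟩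
    refine ⟨h1, h2, fun n x hx => ?_⟩
    rw [partDens_get?_eq h1 h2 n] at hx
    obtain rfl : _ = x := by simpa using hx
    exact_mod_cast h3 n

/-- The leading digit of a point of `boundedDigits B`. -/
lemma exists_digit {B : ℕ} {t : ℝ} (ht : t ∈ boundedDigits B) :
    ∃ A : ℕ, 1 ≤ A ∧ A ≤ B ∧ t * (A + gaussMap t) = 1 := by
  have h0 := ht.2.2 0
  simp only [Function.iterate_zero, id] at h0
  have h1 : (1 : ℤ) ≤ ⌊t⁻¹⌋ := by
    rw [Int.le_floor]
    simpa using (one_le_inv₀ ht.2.1.1).2 ht.2.1.2.le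
  obtain ⟨A, hA⟩ := Int.eq_ofNat_of_zero_le (by omega : (0 : ℤ) ≤ ⌊t⁻¹⌋)
  refine ⟨A, by omega, by omega, ?_⟩
  have : (A : ℝ) + gaussMap t = t⁻¹ := by
    have h := Int.floor_add_fract t⁻¹
    rw [hA] at h
    simpa [gaussMap] using h
  rw [this, mul_inv_cancel₀ ht.2.1.1.ne']

/-- Points of `boundedDigits B` lie between `[0; B, 1, B, 1, …]` and `M = [0; 1, B, 1, B, …]`. -/
lemma boundedDigits_bounds {B : ℕ} {M : ℝ} (hM : 0 < M) (hMB : M ^ 2 + B * M = B)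
    {t : ℝ} (ht : t ∈ boundedDigits B) : t ≤ M ∧ 1 ≤ t * (B + M) := by
  set K := boundedDigits B
  have hne : K.Nonempty := ⟨t, ht⟩
  have hbb : BddBelow K := ⟨0, fun x hx => hx.2.1.1.le⟩
  have hba : BddAbove K := ⟨1, fun x hx => hx.2.1.2.le⟩
  set lo := sInf K
  set hi := sSup K
  have hlo : ∀ x ∈ K, lo ≤ x := fun x hx => csInf_le hbb hx
  have hhi : ∀ x ∈ K, x ≤ hi := fun x hx => le_csSup hba hx
  have hlo0 : 0 ≤ lo := le_csInf hne fun x hx => hx.2.1.1.le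
  have hhi0 : 0 < hi := ht.2.1.1.trans_le (hhi t ht)
  have h1 : hi ≤ 1 / (1 + lo) := by
    refine csSup_le hne fun x hx => ?_
    obtain ⟨A, hA, -, hx1⟩ := exists_digit hx
    have h2 := hlo _ (gaussMap_mem_boundedDigits hx)
    have hA' : (1 : ℝ) ≤ A := by exact_mod_cast hA
    rw [le_div_iff₀ (by positivity), ← hx1]
    exact mul_le_mul_of_nonneg_left (by linarith) hx.2.1.1.le
  have h2 : 1 / (B + hi) ≤ lo := by
    refine le_csInf hne fun x hx => ?_
    obtain ⟨A, -, hA, hx1⟩ := exists_digit hx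
    have h2 := hhi _ (gaussMap_mem_boundedDigits hx)
    have hA' : (A : ℝ) ≤ B := by exact_mod_cast hA
    rw [div_le_iff₀ (by positivity), ← hx1]
    exact mul_le_mul_of_nonneg_left (by linarith) hx.2.1.1.le
  rw [le_div_iff₀ (by positivity)] at h1
  rw [div_le_iff₀ (by positivity)] at h2
  have hB : (0 : ℝ) ≤ B := by positivity
  have h3 : hi ≤ M := by
    by_contra! h
    nlinarith [mul_le_mul_of_nonneg_left h1 hB, mul_le_mul_of_nonneg_left h2 hhi0.le]
  refine ⟨(hhi t ht).trans h3, h2.trans ?_⟩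
  exact mul_le_mul (hlo t ht) (by linarith) (by positivity) ht.2.1.1.le

lemma fract_mem_gapPoints {θ : ℝ} {N i : ℕ} (hi : i ≤ N) : Int.fract (i * θ) ∈ gapPoints θ N :=
  Or.inr ⟨i, hi, rfl⟩

lemma mem_Icc_of_mem_gapPoints {θ : ℝ} {N : ℕ} {x : ℝ} (hx : x ∈ gapPoints θ N) :
    0 ≤ x ∧ x ≤ 1 := by
  rcases hx with rfl | ⟨k, -, rfl⟩
  · norm_num
  · exact ⟨Int.fract_nonneg _, (Int.fract_lt_one _).le⟩

lemma gap_le_of_forall_right {θ H : ℝ} {N : ℕ}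
    (h : ∀ j ≤ N, ∃ i ≤ N, ∃ z : ℤ, ∃ d : ℝ, 0 < d ∧ d ≤ H ∧ (i : ℝ) * θ = j * θ + d + z) :
    ∀ g ∈ gapSet θ N, g ≤ H := by
  rintro g ⟨x, hx, y, hy, hxy, hno, rfl⟩
  rcases hx with rfl | ⟨j, hj, rfl⟩
  · exact absurd (mem_Icc_of_mem_gapPoints hy).2 (not_le.2 hxy)
  obtain ⟨i, hi, z, d, hd, hdH, he⟩ := h j hj
  by_contra! hlt
  have hy1 := (mem_Icc_of_mem_gapPoints hy).2
  have hf : Int.fract (i * θ) = Int.fract (j * θ) + d := by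
    rw [Int.fract_eq_iff]
    refine ⟨by linarith [Int.fract_nonneg ((j : ℝ) * θ)], by linarith, ⌊(j : ℝ) * θ⌋ + z, ?_⟩
    rw [he, Int.fract]
    push_cast
    ring
  exact hno _ (fract_mem_gapPoints hi) (by rw [hf]; constructor <;> linarith)

lemma gap_le_of_forall_left {θ H : ℝ} {N : ℕ}
    (h : ∀ j ≤ N, ∃ i ≤ N, ∃ z : ℤ, ∃ d : ℝ, 0 < d ∧ d ≤ H ∧ (i : ℝ) * θ = j * θ - d + z) :
    ∀ g ∈ gapSet θ N, g ≤ H := by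
  rintro g ⟨x, hx, y, hy, hxy, hno, rfl⟩
  have hx0 := (mem_Icc_of_mem_gapPoints hx).1
  have hy1 := (mem_Icc_of_mem_gapPoints hy).2
  obtain ⟨j, hj, w, hw⟩ : ∃ j ≤ N, ∃ w : ℤ, y = j * θ + w := by
    rcases hy with rfl | ⟨j, hj, rfl⟩
    · exact ⟨0, Nat.zero_le _, 1, by simp⟩
    · exact ⟨j, hj, -⌊(j : ℝ) * θ⌋, by rw [Int.fract]; push_cast; ring⟩
  obtain ⟨i, hi, z, d, hd, hdH, he⟩ := h j hj
  by_contra! hlt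
  have hf : Int.fract (i * θ) = y - d := by
    rw [Int.fract_eq_iff]
    refine ⟨by linarith, by linarith, z - w, ?_⟩
    rw [he, hw]
    push_cast
    ring
  exact hno _ (fract_mem_gapPoints hi) (by rw [hf]; constructor <;> linarith)

/-- Two approximations of `θ` on opposite sides bound every gap. -/
lemma gap_le_of_approx {θ s η η' : ℝ} {N q q' m : ℕ} {p p' : ℤ} (hs : s = 1 ∨ s = -1)
    (hq : q * θ - p = s * η) (hq' : q' * θ - p' = -(s * η')) (hη : 0 < η) (hm : 1 ≤ m)
    (hle : η ≤ η' - (m - 1) * η) (hN : m * q + q' ≤ N + 1) :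
    ∀ g ∈ gapSet θ N, g ≤ η' - (m - 1) * η := by
  have key : ∀ j ≤ N, ∃ i ≤ N, ∃ z : ℤ, ∃ d : ℝ, 0 < d ∧ d ≤ η' - (m - 1) * η ∧
      (i : ℝ) * θ = j * θ + s * d + z := by
    intro j hj
    by_cases hjq : j + q ≤ N
    · refine ⟨j + q, hjq, p, η, hη, hle, ?_⟩
      push_cast
      linear_combination hq
    · obtain ⟨n, rfl⟩ := Nat.exists_eq_add_of_le hm
      have h1 : n * q + q' ≤ j := by
        have : (1 + n) * q = q + n * q := by ring
        omega
      obtain ⟨i, rfl⟩ := Nat.exists_eq_add_of_le h1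
      refine ⟨i, by omega, -(n * p + p'), _, hη.trans_le hle, le_rfl, ?_⟩
      push_cast
      linear_combination (-(n : ℝ)) * hq - hq'
  rcases hs with rfl | rfl
  · exact gap_le_of_forall_right fun j hj => by simpa using key j hj
  · exact gap_le_of_forall_left fun j hj => by simpa [sub_eq_add_neg] using key j hj

lemma bddAbove_gapSet (θ : ℝ) (N : ℕ) : BddAbove (gapSet θ N) := by
  refine ⟨1, ?_⟩
  rintro g ⟨x, hx, y, hy, -, -, rfl⟩
  linarith [(mem_Icc_of_mem_gapPoints hx).1, (mem_Icc_of_mem_gapPoints hy).2]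

lemma finite_gapPoints (θ : ℝ) (N : ℕ) : (gapPoints θ N).Finite := by
  refine Set.Finite.insert _ (((Set.finite_Iic N).image fun k : ℕ => Int.fract (k * θ)).subset ?_)
  rintro x ⟨k, hk, rfl⟩
  exact ⟨k, hk, rfl⟩

/-- If no point `iθ` lies modulo one strictly within `H` to the right of `jθ`, then
`H` is a lower bound for the largest gap. -/
lemma le_maxGap_of_forall_right {θ H : ℝ} {N j : ℕ} (hj : j ≤ N)
    (h : ∀ i ≤ N, ∀ z : ℤ, 0 < (i : ℝ) * θ - j * θ - z → H ≤ (i : ℝ) * θ - j * θ - z) :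
    H ≤ maxGap θ N := by
  set x := Int.fract ((j : ℝ) * θ) with hx
  have hfin : (gapPoints θ N ∩ Set.Ioi x).Finite := (finite_gapPoints θ N).inter_of_left _
  obtain ⟨y, ⟨hy, hxy⟩, hmin⟩ := Set.exists_min_image _ id hfin
    ⟨1, Or.inl rfl, show x < 1 from Int.fract_lt_one _⟩
  have hmem : y - x ∈ gapSet θ N :=
    ⟨x, fract_mem_gapPoints hj, y, hy, hxy, fun c hc hcx =>
      absurd (hmin c ⟨hc, hcx.1⟩) (not_le.2 hcx.2), rfl⟩
  refine le_trans ?_ (le_csSup (bddAbove_gapSet θ N) hmem)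
  have hxy' : x < y := hxy
  obtain ⟨i, hi, w, hw⟩ : ∃ i ≤ N, ∃ w : ℤ, y = i * θ + w := by
    rcases hy with rfl | ⟨i, hi, rfl⟩
    · exact ⟨0, Nat.zero_le _, 1, by simp⟩
    · exact ⟨i, hi, -⌊(i : ℝ) * θ⌋, by rw [Int.fract]; push_cast; ring⟩
  have he : y - x = i * θ - j * θ - ((-w - ⌊(j : ℝ) * θ⌋ : ℤ) : ℝ) := by
    rw [hw, hx, Int.fract]
    push_cast
    ring
  rw [he]
  apply h i hi
  rw [← he]
  linarith

lemma le_maxGap_of_approx {θ η η' : ℝ} {N q q' m : ℕ} {p p' : ℤ} (hq : q * θ - p = η)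
    (hq' : q' * θ - p' = -η') (hη : 0 < η) (hη' : 0 < η')
    (hdet : (q : ℤ) * p' - q' * p = 1) (hq1 : 1 ≤ q) (hm : 1 ≤ m)
    (hN : N + 2 = (m + 1) * q + q') : η' - (m - 1) * η ≤ maxGap θ N := by
  have hmq : q ≤ m * q := Nat.le_mul_of_pos_left q hm
  have hN' : N + 2 = m * q + q + q' := by rw [hN]; ring
  refine le_maxGap_of_forall_right (j := N + 1 - q) (by omega) fun i hi z hw => ?_
  by_contra! hlt
  obtain ⟨j, hj⟩ : ∃ j : ℕ, j = N + 1 - q := ⟨_, rfl⟩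
  rw [← hj] at hw hlt
  set x : ℤ := (i - j) * p' - z * q' with hx
  set y : ℤ := q * z - (i - j) * p with hy
  have hd : (i : ℤ) - j = x * q + y * q' := by
    rw [hx, hy]
    linear_combination (-((i : ℤ) - j)) * hdet
  have hz : z = x * p + y * p' := by
    rw [hx, hy]
    linear_combination (-z) * hdet
  have hdR : (i : ℝ) - j = x * q + y * q' := by exact_mod_cast hd
  have hzR : (z : ℝ) = x * p + y * p' := by exact_mod_cast hz
  have hwe : (i : ℝ) * θ - j * θ - z = x * η - y * η' := by
    linear_combination θ * hdR - hzR + x * hq + y * hq'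
  rw [hwe] at hw hlt
  rcases le_or_gt 0 y with h0 | h0
  · have hyR : (0 : ℝ) ≤ y := by exact_mod_cast h0
    have hx0 : (0 : ℝ) < x := by
      by_contra! hneg
      nlinarith [mul_nonneg hyR hη'.le]
    have hx1 : 1 ≤ x := by
      have : 0 < x := by exact_mod_cast hx0
      omega
    have h1 : (q : ℤ) ≤ x * q := by nlinarith
    have h2 : 0 ≤ y * q' := by positivity
    omega
  · have hyR : (y : ℝ) ≤ -1 := by
      have : y ≤ -1 := by omega
      exact_mod_cast this
    have hx0 : (x : ℝ) < -(m - 1) := by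
      by_contra! hneg
      nlinarith
    have hx1 : x ≤ -m := by
      have : x < -((m : ℤ) - 1) := by exact_mod_cast hx0
      omega
    have h1 : x * q ≤ -(m * q : ℕ) := by push_cast; nlinarith
    have h2 : y * q' ≤ -q' := by nlinarith
    omega

/-- The numerical inequality behind the upper bound for `B = 1`; `D` is `√5`. -/
lemma gap_product_le_of_one {D f q q' y : ℝ} (hD : 0 < D) (hD2 : D ^ 2 = 5)
    (hf : 4 * D * f = (D + 1) * (D + 3)) (hq' : q' ≤ (D - 1) / 2 * q + 1)
    (hq'' : q ≤ (q' + 1) * (1 + (D - 1) / 2)) (hy : y ≤ (D - 1) / 2)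
    (hy' : 1 ≤ y * (1 + (D - 1) / 2)) :
    (2 * q + q' - 2) * (1 + y) ≤ f * (q * (1 + y) + q') := by
  have hD1 : 2 ≤ D := by nlinarith
  obtain ⟨g, rfl⟩ : ∃ g, D = 1 + 2 * g := ⟨(D - 1) / 2, by ring⟩
  have e : (1 + 2 * g - 1) / 2 = g := by ring
  rw [e] at hq' hq'' hy hy'
  have hg : g * (1 + g) = 1 := by linarith
  have hg0 : 0 < g := by linarith
  obtain rfl : y = g := by
    refine le_antisymm hy ?_
    by_contra! h
    nlinarith
  obtain ⟨δ, rfl⟩ : ∃ δ, q' = y * q + δ := ⟨q' - y * q, by ring⟩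
  have hδ : -1 ≤ δ := by
    have h := mul_le_mul_of_nonneg_left hq'' hg0.le
    have h' : y * ((y * q + δ + 1) * (1 + y)) = (y * q + δ + 1) * (y * (1 + y)) := by ring
    rw [h', hg] at h
    linarith
  have hf' : (1 + 2 * y) * f = (1 + y) * (2 + y) := by linarith
  have hf0 : 0 < f := by
    by_contra! h
    nlinarith
  have hf2 : f ≤ 2 := by
    by_contra! h
    nlinarith
  have h1 : 0 ≤ (1 - δ) * (3 + 3 * y - f) := mul_nonneg (by linarith) (by linarith)
  have h2 : 0 ≤ (1 + δ) * (1 + y + f) := mul_nonneg (by linarith) (by linarith)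
  have h3 : (2 * q + (y * q + δ) - 2) * (1 + y) = (1 + y) * (2 + y) * q + (δ - 2) * (1 + y) := by
    ring
  rw [h3, ← hf']
  linarith

/-- The numerical inequality behind the upper bound; `D` is `√(B² + 4 B)`. -/
lemma gap_product_le {a m A : ℕ} {D f q q' y : ℝ} (hD : 0 < D)
    (hD2 : D ^ 2 = 4 * (a : ℝ) ^ 2 + 12 * a + 5) (hf : 4 * D * f = (D + 1) * (D + 3))
    (hm : 1 ≤ m) (hmA : m ≤ A) (hA : A ≤ 2 * a + 1) (hq : 0 < q) (hq'0 : 0 ≤ q')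
    (hq' : q' ≤ (D - (2 * a + 1)) / 2 * q + 1)
    (hq'' : q ≤ (q' + 1) * ((2 * a + 1) + (D - (2 * a + 1)) / 2)) (hy0 : 0 < y)
    (hy : y ≤ (D - (2 * a + 1)) / 2) (hy' : 1 ≤ y * ((2 * a + 1) + (D - (2 * a + 1)) / 2)) :
    ((m + 1) * q + q' - 2) * (A - m + 1 + y) ≤ f * (q * (A + y) + q') := by
  have hf0 : 0 < f := by
    by_contra! h
    nlinarith
  rcases Nat.eq_zero_or_pos a with rfl | ha
  · obtain rfl : A = 1 := by omega
    obtain rfl : m = 1 := by omega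
    have h := gap_product_le_of_one (q := q) (q' := q') (y := y) hD (by simpa using hD2) hf
      (by simpa using hq') (by simpa using hq'') (by simpa using hy) (by simpa using hy')
    norm_num
    linarith
  have ha1 : (1 : ℝ) ≤ a := by exact_mod_cast ha
  have hD3 : 3 ≤ D := by nlinarith
  have hf2 : 2 ≤ f := by
    by_contra! h
    nlinarith
  have hmR : (1 : ℝ) ≤ m := by exact_mod_cast hm
  have hmAR : (m : ℝ) ≤ A := by exact_mod_cast hmA
  have hAR : (A : ℝ) ≤ 2 * a + 1 := by exact_mod_cast hA
  obtain ⟨v, hv⟩ : ∃ v : ℝ, v = A - m + 1 + y := ⟨_, rfl⟩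
  have hAy : (A : ℝ) + y = v + m - 1 := by rw [hv]; ring
  have hv0 : 0 < v := by linarith
  rw [← hv, hAy]
  rcases le_or_gt v f with hvf | hvf
  · have h1 : 0 ≤ (f - v) * ((m - 1) * q + q') :=
      mul_nonneg (by linarith) (add_nonneg (mul_nonneg (by linarith) hq.le) hq'0)
    have h2 : 0 ≤ v * (f - 2) * q := mul_nonneg (mul_nonneg hv0.le (by linarith)) hq.le
    linarith
  · obtain ⟨M, hM⟩ : ∃ M : ℝ, M = (D - (2 * a + 1)) / 2 := ⟨_, rfl⟩
    rw [← hM] at hq' hy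
    have hF : 0 ≤ f * (m + 1 + M + v - 2) - (m + 1 + M) * v := by
      rcases le_or_gt (m + 1 + M) f with hU | hU
      · have h1 : 0 ≤ (f - (m + 1 + M)) * (v - 2) := mul_nonneg (by linarith) (by linarith)
        have h2 : 0 ≤ (m + 1 + M) * (f - 2) := mul_nonneg (by linarith) (by linarith)
        linarith
      · obtain ⟨V, hV⟩ : ∃ V : ℝ, V = 2 * a + 1 - m + 1 + M := ⟨_, rfl⟩
        have h1 : 0 ≤ (m + 1 + M - f) * (V - v) := mul_nonneg (by linarith) (by linarith)
        have hodd : (1 : ℝ) ≤ (2 * m - (2 * a + 1)) ^ 2 := by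
          have : (1 : ℤ) ≤ (2 * m - (2 * a + 1)) ^ 2 := by
            have h0 : (2 * m - (2 * a + 1) : ℤ) ≠ 0 := by omega
            have := sq_pos_of_ne_zero h0
            omega
          exact_mod_cast this
        have h2 : f * (m + 1 + M + V - 2) = f * D := by rw [hV, hM]; ring
        have h3 : 4 * ((m + 1 + M) * V) = (D + 2) ^ 2 - (2 * m - (2 * a + 1)) ^ 2 := by
          rw [hV, hM]; ring
        linarith
    have h5 : 0 ≤ (v - f) * (M * q + 1 - q') := mul_nonneg (by linarith) (by linarith)
    have h6 := mul_nonneg hF hq.le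
    linarith

/-- Every `N H(θ, N)` with `N + 1 ≥ q + q'`, where `q`, `q'` are consecutive convergent
denominators of `θ`, is bounded; the induction is on `N + 1 - (q + q')`. -/
lemma mul_maxGap_le_of_approx {a : ℕ} {D f θ : ℝ} {N : ℕ} (hD : 0 < D)
    (hD2 : D ^ 2 = 4 * (a : ℝ) ^ 2 + 12 * a + 5) (hf : 4 * D * f = (D + 1) * (D + 3)) (k : ℕ) :
    ∀ (q q' : ℕ) (p p' : ℤ) (s η η' t : ℝ), (s = 1 ∨ s = -1) → q * θ - p = s * η →
      q' * θ - p' = -(s * η') → 0 < η' → η = t * η' → t ∈ boundedDigits (2 * a + 1) →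
      q * η' + q' * η = 1 → 1 ≤ q → (q' : ℝ) ≤ (D - (2 * a + 1)) / 2 * q + 1 →
      q ≤ ((q' : ℝ) + 1) * ((2 * a + 1) + (D - (2 * a + 1)) / 2) →
      q + q' ≤ N + 1 → N + 1 ≤ q + q' + k → N * maxGap θ N ≤ f := by
  have hB : D - (2 * a + 1) > 0 := by
    have : (0 : ℝ) ≤ a := by positivity
    nlinarith
  obtain ⟨M, hM⟩ : ∃ M : ℝ, M = (D - (2 * a + 1)) / 2 := ⟨_, rfl⟩
  have hM0 : 0 < M := by rw [hM]; linarith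
  have hMB : M ^ 2 + (2 * a + 1) * M = 2 * a + 1 := by
    rw [hM]
    linear_combination hD2 / 4
  have hbounds : ∀ t ∈ boundedDigits (2 * a + 1), t ≤ M ∧ 1 ≤ t * ((2 * a + 1) + M) := by
    intro t ht
    simpa using boundedDigits_bounds (B := 2 * a + 1) hM0 (by push_cast; exact hMB) ht
  rw [← hM]
  induction k using Nat.strong_induction_on with
  | _ k ih =>
  intro q q' p p' s η η' t hs hq hq' hη' ht htK hdet hq1 hup hlow hN hk
  obtain ⟨A, hA1, hAB, htA⟩ := exists_digit htK
  have hyK := gaussMap_mem_boundedDigits htK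
  obtain ⟨y, hy⟩ : ∃ y, y = gaussMap t := ⟨_, rfl⟩
  rw [← hy] at htA hyK
  have hy0 := hyK.2.1.1
  have hη : 0 < η := ht ▸ mul_pos htK.2.1.1 hη'
  have hη'e : η' = (A + y) * η := by
    rw [ht]
    linear_combination (-η') * htA
  have hqR : (1 : ℝ) ≤ q := by exact_mod_cast hq1
  have hAR : (1 : ℝ) ≤ A := by exact_mod_cast hA1
  have hABR : (A : ℝ) ≤ 2 * a + 1 := by exact_mod_cast hAB
  have hqA : q ≤ A * q := Nat.le_mul_of_pos_left q hA1
  by_cases hcase : N + 1 < (A + 1) * q + q'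
  · obtain ⟨m, hm⟩ : ∃ m, m = (N + 1 - q') / q := ⟨_, rfl⟩
    have hm1 : m * q ≤ N + 1 - q' := hm ▸ Nat.div_mul_le_self _ _
    have hm2 : N + 1 - q' < (m + 1) * q := by
      rw [hm, mul_comm]
      exact Nat.lt_mul_div_succ _ hq1
    have hm3 : 1 ≤ m := hm ▸ (Nat.one_le_div_iff hq1).2 (by omega)
    have hmA : m ≤ A := by
      have : m < A + 1 := hm ▸ (Nat.div_lt_iff_lt_mul hq1).2 (by omega)
      omega
    have hmR : (1 : ℝ) ≤ m := by exact_mod_cast hm3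
    have hmAR : (m : ℝ) ≤ A := by exact_mod_cast hmA
    have hHe : η' - (m - 1) * η = (A - m + 1 + y) * η := by rw [hη'e]; ring
    have hle : η ≤ η' - (m - 1) * η := by
      rw [hHe]
      exact le_mul_of_one_le_left hη.le (by linarith)
    have hmax : maxGap θ N ≤ (A - m + 1 + y) * η := by
      refine Real.sSup_le (fun g hg => ?_) (mul_nonneg (by linarith) hη.le)
      rw [← hHe]
      exact gap_le_of_approx hs hq hq' hη hm3 hle (by omega) g hg
    have hNle : (N : ℝ) ≤ (m + 1) * q + q' - 2 := by
      have : N + 2 ≤ (m + 1) * q + q' := by omega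
      have : (N : ℝ) + 2 ≤ (m + 1) * q + q' := by exact_mod_cast this
      linarith
    have hineq := gap_product_le (m := m) (A := A) (q := q) (q' := q') hD hD2 hf hm3 hmA hAB
      (by linarith) (by positivity) (by rw [← hM]; exact hup) (by rw [← hM]; exact hlow) hy0
      (by rw [← hM]; exact (hbounds y hyK).1) (by rw [← hM]; exact (hbounds y hyK).2)
    have hdet' : (q * (A + y) + q') * η = 1 := by
      rw [hη'e] at hdet
      linarith
    calc N * maxGap θ N ≤ N * ((A - m + 1 + y) * η) :=
          mul_le_mul_of_nonneg_left hmax (by positivity)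
      _ ≤ ((m + 1) * q + q' - 2) * ((A - m + 1 + y) * η) :=
          mul_le_mul_of_nonneg_right hNle (mul_nonneg (by linarith) hη.le)
      _ = ((m + 1) * q + q' - 2) * (A - m + 1 + y) * η := by ring
      _ ≤ f * (q * (A + y) + q') * η := mul_le_mul_of_nonneg_right hineq hη.le
      _ = f := by rw [mul_assoc, hdet', mul_one]
  · have hexp : (A + 1) * q + q' = A * q + q + q' := by ring
    have hqR0 : (0 : ℝ) ≤ q := by linarith
    have hAq : (A : ℝ) * q ≤ (2 * a + 1) * q := mul_le_mul_of_nonneg_right hABR hqR0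
    have hAq' : (q : ℝ) ≤ A * q := le_mul_of_one_le_left hqR0 hAR
    have hBM : 0 < 2 * (a : ℝ) + 1 + M := by positivity
    refine ih (k - 1) (by omega) (A * q + q') q (A * p + p') p (-s) (y * η) η y ?_ ?_ ?_ hη rfl
      hyK ?_ (by omega) ?_ ?_ (by omega) (by omega)
    · rcases hs with rfl | rfl <;> simp
    · push_cast
      linear_combination (A : ℝ) * hq + hq' - s * hη'e
    · linear_combination hq
    · push_cast
      rw [hη'e] at hdet
      linear_combination hdet
    · push_cast
      have h := mul_le_mul_of_nonneg_left hlow hM0.le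
      have e : (2 * (a : ℝ) + 1 + M) * M = 2 * a + 1 := by linarith
      have e' : (q : ℝ) * ((2 * a + 1 + M) * M) = q * (2 * a + 1) := by rw [e]
      have e'' : M * (A * q + q') ≥ M * (q + q') :=
        mul_le_mul_of_nonneg_left (by linarith) hM0.le
      refine le_trans ?_ (add_le_add_left e'' 1)
      refine le_of_mul_le_mul_right ?_ hBM
      linarith
    · push_cast
      linarith

lemma mul_maxGap_le {a : ℕ} {D f θ : ℝ} (hD : 0 < D)
    (hD2 : D ^ 2 = 4 * (a : ℝ) ^ 2 + 12 * a + 5) (hf : 4 * D * f = (D + 1) * (D + 3))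
    (hθ : θ ∈ SB (2 * a + 1)) (N : ℕ) : N * maxGap θ N ≤ f := by
  rw [SB_eq_boundedDigits] at hθ
  have ha : (0 : ℝ) ≤ a := by positivity
  have hB : 2 * a + 1 < D := by nlinarith
  exact mul_maxGap_le_of_approx hD hD2 hf N 1 0 0 1 1 θ 1 θ (Or.inl rfl) (by simp) (by simp)
    one_pos (by simp) hθ (by simp) le_rfl (by push_cast; linarith) (by push_cast; linarith)
    (by omega) (by omega)

lemma irrational_of_sq_eq {a : ℕ} {D : ℝ} (hD : 0 < D)
    (hD2 : D ^ 2 = 4 * (a : ℝ) ^ 2 + 12 * a + 5) : Irrational D := by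
  have h : D = √((4 * a ^ 2 + 12 * a + 5 : ℕ) : ℝ) := by
    rw [eq_comm, Real.sqrt_eq_iff_mul_self_eq_of_pos hD]
    push_cast
    linarith
  rw [h, irrational_sqrt_natCast_iff]
  rintro ⟨r, hr⟩
  have h1 : r < 2 * a + 3 := by nlinarith
  have h2 : 2 * a + 1 < r := by nlinarith
  obtain rfl : r = 2 * a + 2 := by omega
  ring_nf at hr
  omega

/-- The number `[0; B, 1, B, 1, …]` lies in `S_B`. -/
lemma inv_add_mem_SB {B : ℕ} {M : ℝ} (hB : 1 ≤ B) (hM : 0 < M) (hMB : M ^ 2 + B * M = B)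
    (hirr : Irrational M) : ((B : ℝ) + M)⁻¹ ∈ SB B := by
  rw [SB_eq_boundedDigits]
  have hBR : (1 : ℝ) ≤ B := by exact_mod_cast hB
  have hM1 : M < 1 := by
    by_contra! h
    nlinarith
  have hpos : 0 < (B : ℝ) + M := by linarith
  have hMinv : M⁻¹ = 1 + ((B : ℝ) + M)⁻¹ := by
    field_simp
    linarith
  have hfloor : ⌊(B : ℝ) + M⌋ = B := by
    rw [Int.floor_eq_iff]
    constructor <;> push_cast <;> linarith
  have hθ : ((B : ℝ) + M)⁻¹ ∈ Set.Ioo (0 : ℝ) 1 :=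
    ⟨by positivity, inv_lt_one_of_one_lt₀ (by linarith)⟩
  have hfloor' : ⌊M⁻¹⌋ = 1 := by
    rw [hMinv, Int.floor_eq_iff]
    constructor <;> push_cast <;> linarith [hθ.1, hθ.2]
  have hit : ∀ n, gaussMap^[n] ((B : ℝ) + M)⁻¹ = ((B : ℝ) + M)⁻¹ ∨
      gaussMap^[n] ((B : ℝ) + M)⁻¹ = M := by
    intro n
    induction n with
    | zero => exact Or.inl rfl
    | succ n ih =>
      rw [Function.iterate_succ_apply']
      rcases ih with ih | ih <;> rw [ih]
      · right
        rw [gaussMap, inv_inv, Int.fract, hfloor]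
        push_cast
        ring
      · left
        rw [gaussMap, Int.fract, hfloor', hMinv]
        push_cast
        ring
  refine ⟨(hirr.natCast_add B).inv, hθ, fun n => ?_⟩
  rcases hit n with h | h <;> rw [h]
  · rw [inv_inv, hfloor]
  · rw [hfloor']
    exact_mod_cast hB

/-- Even-indexed convergents of `θ = [0; B, 1, B, 1, …]`. -/
lemma exists_convergents {B : ℕ} {M θ : ℝ} (hB : 1 ≤ B) (hθ : θ * (B + M) = 1)
    (hMθ : M + M * θ = 1) (n : ℕ) :
    ∃ (q q' : ℕ) (p p' : ℤ), n + 1 ≤ q ∧ q * θ - p = θ * (M * θ) ^ n ∧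
      q' * θ - p' = -(M * θ) ^ n ∧ (q : ℤ) * p' - q' * p = 1 ∧
      (q' : ℝ) = M * q - M * (M * θ) ^ n := by
  induction n with
  | zero => exact ⟨1, 0, 0, 1, by simp⟩
  | succ n ih =>
    obtain ⟨q, q', p, p', h1, h2, h3, h4, h5⟩ := ih
    have hBq : q ≤ B * q := Nat.le_mul_of_pos_left q hB
    refine ⟨B * q + q' + q, B * q + q', B * p + p' + p, B * p + p', by omega, ?_, ?_, ?_, ?_⟩
    · push_cast
      linear_combination ((B : ℝ) + 1) * h2 + h3 + (M * θ) ^ n * hθ - θ * (M * θ) ^ n * hMθ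
    · push_cast
      linear_combination (B : ℝ) * h2 + h3 + (M * θ) ^ n * hθ
    · push_cast
      linear_combination h4
    · push_cast
      linear_combination M * θ * h5 - ((B : ℝ) * q + q') * hMθ + M * q * hθ

lemma exists_mul_maxGap_ge {a : ℕ} {D f ε : ℝ} (hD : 0 < D)
    (hD2 : D ^ 2 = 4 * (a : ℝ) ^ 2 + 12 * a + 5) (hf : 4 * D * f = (D + 1) * (D + 3))
    (hε : 0 < ε) : ∃ θ ∈ SB (2 * a + 1), ∃ N : ℕ, 1 ≤ N ∧ f - ε ≤ N * maxGap θ N := by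
  have ha : (0 : ℝ) ≤ a := by positivity
  have hB : 2 * a + 1 < D := by nlinarith
  obtain ⟨M, rfl⟩ : ∃ M, D = 2 * a + 1 + 2 * M := ⟨(D - (2 * a + 1)) / 2, by ring⟩
  have hM : 0 < M := by linarith
  have hMB : M ^ 2 + (2 * a + 1) * M = 2 * a + 1 := by linarith
  have hirr : Irrational M := by
    have h := irrational_of_sq_eq hD hD2
    have e : (2 * a + 1 + 2 * M : ℝ) = ((2 * a + 1 : ℕ) : ℝ) + ((2 : ℕ) : ℝ) * M := by
      push_cast
      ring
    rw [e] at h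
    exact (h.of_natCast_add _).of_natCast_mul _
  have hM1 : M < 1 := by
    by_contra! h
    nlinarith
  have hSB := inv_add_mem_SB (B := 2 * a + 1) (by omega) hM (by push_cast; exact hMB) hirr
  obtain ⟨θ, hθ⟩ : ∃ θ, θ = (((2 * a + 1 : ℕ) : ℝ) + M)⁻¹ := ⟨_, rfl⟩
  rw [← hθ] at hSB
  have hBM : (0 : ℝ) < ((2 * a + 1 : ℕ) : ℝ) + M := by positivity
  have hθ1 : θ * (((2 * a + 1 : ℕ) : ℝ) + M) = 1 := by
    rw [hθ, inv_mul_cancel₀ hBM.ne']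
  have hMθ : M + M * θ = 1 := by
    rw [hθ]
    field_simp
    push_cast
    linarith
  obtain ⟨hθ0, hθlt⟩ := hSB.2.1
  have hr0 : 0 < M * θ := mul_pos hM hθ0
  have hr1 : M * θ < 1 := by linarith
  obtain ⟨n, hn⟩ := exists_pow_lt_of_lt_one (by positivity : 0 < ε / 3) hr1
  obtain ⟨q, q', p, p', h1, h2, h3, h4, h5⟩ :=
    exists_convergents (B := 2 * a + 1) (by omega) hθ1 hMθ (n + 1)
  obtain ⟨R, hR⟩ : ∃ R, R = (M * θ) ^ (n + 1) := ⟨_, rfl⟩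
  rw [← hR] at h2 h3 h5
  have hR0 : 0 < R := hR ▸ pow_pos hr0 _
  have hRε : 3 * R ≤ ε := by
    have : R ≤ (M * θ) ^ n := hR ▸ pow_le_pow_of_le_one hr0.le hr1.le (Nat.le_succ n)
    linarith
  have hR1 : R ≤ 1 := hR ▸ pow_le_one₀ hr0.le hr1.le
  have hq : 2 ≤ q := by omega
  have haq : 2 * (a + 2) ≤ (a + 2) * q := by nlinarith
  refine ⟨θ, hSB, (a + 2) * q + q' - 2, by omega, ?_⟩
  have hgap := le_maxGap_of_approx (N := (a + 2) * q + q' - 2) (m := a + 1) h2 h3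
    (mul_pos hθ0 hR0) hR0 h4 (by omega) (by omega)
    (by rw [show a + 1 + 1 = a + 2 from rfl]; omega)
  have hcast : (((a + 2) * q + q' - 2 : ℕ) : ℝ) = (a + 2) * q + q' - 2 := by
    rw [Nat.cast_sub (by omega)]
    push_cast
    ring
  refine le_trans ?_ (mul_le_mul_of_nonneg_left hgap (by positivity))
  rw [hcast]
  push_cast at hθ1 ⊢
  have hf0 : 0 < f := by
    by_contra! h
    nlinarith
  have hdetR : (q : ℝ) * p' - q' * p = 1 := by exact_mod_cast h4
  have hqR : q * R * (1 + M * θ) = 1 + M * θ * R ^ 2 := by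
    linear_combination -q' * h2 + q * h3 + hdetR - θ * R * h5
  obtain ⟨w, hw⟩ : ∃ w : ℝ, w = 1 - a * θ := ⟨_, rfl⟩
  have hw' : w = θ * (a + 1 + M) := by linarith
  have hw0 : 0 ≤ w := hw' ▸ by positivity
  have hw1 : w ≤ 1 := by
    have : 0 ≤ a * θ := by positivity
    linarith
  have hfw : f * (1 + M * θ) = (a + 2 + M) * w := by
    rw [hw']
    linear_combination θ / 4 * hf - f * hθ1
  have hNH : ((a + 2) * q + q' - 2) * (R - (a + 1 - 1) * (θ * R)) =
      f + f * (M * θ * R ^ 2) - (M * R * R + 2 * R) * w := by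
    rw [h5, hw]
    rw [hw] at hfw
    linear_combination f * hqR - q * R * hfw
  rw [hNH]
  have h6 : 0 ≤ f * (M * θ * R ^ 2) := by positivity
  have h7 : (M * R * R + 2 * R) * w ≤ M * R * R + 2 * R :=
    mul_le_of_le_one_right (by positivity) hw1
  have h8 : M * R * R ≤ R := mul_le_of_le_one_left hR0.le (mul_le_one₀ hM1.le hR0.le hR1)
  linarith

/-- **Theorem 4, odd case.**  For `B = 2a+1` with `a ≥ 0`,
`f(B) = 1 + (a²+3a+2) / √(4a²+12a+5)`. -/
theorem badF_odd (a : ℕ) :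
    badF (2 * a + 1) =
      1 + ((a : ℝ) ^ 2 + 3 * a + 2) / Real.sqrt (4 * (a : ℝ) ^ 2 + 12 * a + 5) := by
  obtain ⟨D, hDdef⟩ : ∃ D, D = Real.sqrt (4 * (a : ℝ) ^ 2 + 12 * a + 5) := ⟨_, rfl⟩
  have hD : 0 < D := hDdef ▸ Real.sqrt_pos.2 (by positivity)
  have hD2 : D ^ 2 = 4 * (a : ℝ) ^ 2 + 12 * a + 5 := hDdef ▸ Real.sq_sqrt (by positivity)
  rw [← hDdef]
  obtain ⟨f, hfdef⟩ : ∃ f, f = 1 + ((a : ℝ) ^ 2 + 3 * a + 2) / D := ⟨_, rfl⟩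
  rw [← hfdef]
  have hf0 : 0 ≤ f := by rw [hfdef]; positivity
  have hf : 4 * D * f = (D + 1) * (D + 3) := by
    rw [hfdef]
    field_simp
    linear_combination -hD2
  have hup : ∀ x ∈ {x : ℝ | ∃ θ ∈ SB (2 * a + 1), ∃ N : ℕ, 1 ≤ N ∧ x = (N : ℝ) * maxGap θ N},
      x ≤ f := by
    rintro x ⟨θ, hθ, N, -, rfl⟩
    exact mul_maxGap_le hD hD2 hf hθ N
  refine le_antisymm (Real.sSup_le hup hf0) (le_of_forall_pos_sub_le fun ε hε => ?_)
  obtain ⟨θ, hθ, N, hN, hlt⟩ := exists_mul_maxGap_ge hD hD2 hf hε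
  exact hlt.trans (le_csSup ⟨f, hup⟩ ⟨θ, hθ, N, hN, rfl⟩)
end

section
/- Let a be a positive integer and let B = 2a. Then sup over θ ∈ S_B, over k ≥ 1, and over integers N with q_k + q_{k−1} ≤ N < q_{k+1} (where p_k/q_k are the convergents of θ) of N·H(θ, N) equals 1 + (a+1)²/(2·√(a²+2a)). -/
/-- The orbit of `θ` under the Gauss map `x ↦ {1/x}`. -/
noncomputable def gaussOrbit (θ : ℝ) : ℕ → ℝ
  | 0 => θ
  | n + 1 => Int.fract (gaussOrbit θ n)⁻¹

/-- The partial quotients read off from the Gauss map orbit; `gaussDigit θ n` is `a_{n+1}`. -/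
noncomputable def gaussDigit (θ : ℝ) (n : ℕ) : ℤ := ⌊(gaussOrbit θ n)⁻¹⌋

/-- The integer denominators of the convergents of `θ ∈ (0,1)`. -/
noncomputable def cfDen (θ : ℝ) : ℕ → ℤ
  | 0 => 1
  | 1 => gaussDigit θ 0
  | n + 2 => gaussDigit θ (n + 1) * cfDen θ (n + 1) + cfDen θ n

/-- The integer numerators of the convergents of `θ ∈ (0,1)`. -/
noncomputable def cfNum (θ : ℝ) : ℕ → ℤ
  | 0 => 0
  | 1 => 1
  | n + 2 => gaussDigit θ (n + 1) * cfNum θ (n + 1) + cfNum θ n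

/-- The approximation error `|q_n θ - p_n|`, as a product of terms of the Gauss map orbit. -/
noncomputable def cfErr (θ : ℝ) : ℕ → ℝ
  | 0 => θ
  | n + 1 => cfErr θ n * gaussOrbit θ (n + 1)

section Convergents

variable {θ : ℝ}

lemma gaussOrbit_irrational (h : Irrational θ) (n : ℕ) : Irrational (gaussOrbit θ n) := by
  induction n with
  | zero => exact h
  | succ n ih =>
    simp only [gaussOrbit, Int.fract]
    exact (irrational_inv_iff.mpr ih).sub_intCast _

lemma gaussOrbit_mem_Ioo (h : Irrational θ) (h01 : θ ∈ Set.Ioo (0 : ℝ) 1) (n : ℕ) :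
    gaussOrbit θ n ∈ Set.Ioo (0 : ℝ) 1 := by
  cases n with
  | zero => exact h01
  | succ n =>
    refine ⟨lt_of_le_of_ne (Int.fract_nonneg _) ?_, Int.fract_lt_one _⟩
    exact (gaussOrbit_irrational h (n + 1)).ne_zero.symm

lemma gaussOrbit_succ (θ : ℝ) (n : ℕ) :
    gaussOrbit θ (n + 1) = (gaussOrbit θ n)⁻¹ - gaussDigit θ n := rfl

lemma one_le_gaussDigit (h : Irrational θ) (h01 : θ ∈ Set.Ioo (0 : ℝ) 1) (n : ℕ) :
    1 ≤ gaussDigit θ n := by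
  obtain ⟨h0, h1⟩ := gaussOrbit_mem_Ioo h h01 n
  rw [gaussDigit, Int.le_floor]
  push_cast
  exact (one_lt_inv₀ h0).mpr h1 |>.le

lemma gaussOrbit_fract_inv (θ : ℝ) (n : ℕ) :
    gaussOrbit (Int.fract θ⁻¹) n = gaussOrbit θ (n + 1) := by
  induction n with
  | zero => rfl
  | succ n ih => rw [gaussOrbit, ih, ← gaussOrbit]

lemma of_s_get?_eq_gaussDigit (h : Irrational θ) (n : ℕ) :
    (GenContFract.of θ).s.get? n =
      some ⟨1, (gaussDigit (Int.fract θ) n : ℝ)⟩ := by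
  induction n generalizing θ with
  | zero =>
    have : Int.fract θ ≠ 0 := (h.sub_intCast ⌊θ⌋).ne_zero
    exact GenContFract.of_s_head this
  | succ n ih =>
    have hf : Irrational (Int.fract θ)⁻¹ := irrational_inv_iff.mpr (h.sub_intCast ⌊θ⌋)
    rw [GenContFract.of_s_succ, ih hf, gaussDigit, gaussDigit, gaussOrbit_fract_inv]

lemma of_dens_eq_cfDen (h : Irrational θ) (h01 : θ ∈ Set.Ioo (0 : ℝ) 1) (n : ℕ) :
    (GenContFract.of θ).dens n = cfDen θ n := by
  have hs := of_s_get?_eq_gaussDigit h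
  rw [Int.fract_eq_self.mpr ⟨h01.1.le, h01.2⟩] at hs
  induction n using Nat.twoStepInduction with
  | zero => simp [cfDen]
  | one => simp [cfDen, GenContFract.first_den_eq (hs 0)]
  | more n ih1 ih2 =>
    rw [GenContFract.dens_recurrence (hs (n + 1)) ih1 ih2, cfDen]
    push_cast
    ring

lemma partQuotBounded_iff (h : Irrational θ) (h01 : θ ∈ Set.Ioo (0 : ℝ) 1) (B : ℕ) :
    PartQuotBounded θ B ↔ ∀ n, gaussDigit θ n ≤ B := by
  have hs := of_s_get?_eq_gaussDigit h
  rw [Int.fract_eq_self.mpr ⟨h01.1.le, h01.2⟩] at hs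
  refine forall_congr' fun n => ?_
  rw [GenContFract.partDen_eq_s_b (hs n)]
  simp only [Option.mem_def, Option.some.injEq, forall_eq']
  exact_mod_cast Iff.rfl

lemma cfDen_pos (h : Irrational θ) (h01 : θ ∈ Set.Ioo (0 : ℝ) 1) (n : ℕ) : 0 < cfDen θ n := by
  induction n using Nat.twoStepInduction with
  | zero => simp [cfDen]
  | one => exact one_le_gaussDigit h h01 0
  | more n ih1 ih2 =>
    have := one_le_gaussDigit h h01 (n + 1)
    rw [cfDen]
    positivity

lemma succ_le_cfDen_succ (h : Irrational θ) (h01 : θ ∈ Set.Ioo (0 : ℝ) 1) (n : ℕ) :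
    (n : ℤ) + 1 ≤ cfDen θ (n + 1) := by
  induction n with
  | zero => simpa [cfDen] using one_le_gaussDigit h h01 0
  | succ n ih =>
    have h1 := one_le_gaussDigit h h01 (n + 1)
    have h2 := cfDen_pos h h01 n
    rw [cfDen]
    push_cast
    nlinarith

lemma cfErr_pos (h : Irrational θ) (h01 : θ ∈ Set.Ioo (0 : ℝ) 1) (n : ℕ) : 0 < cfErr θ n := by
  induction n with
  | zero => exact h01.1
  | succ n ih => exact mul_pos ih (gaussOrbit_mem_Ioo h h01 _).1

lemma cfErr_le_one (h : Irrational θ) (h01 : θ ∈ Set.Ioo (0 : ℝ) 1) (n : ℕ) :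
    cfErr θ n ≤ 1 := by
  induction n with
  | zero => exact h01.2.le
  | succ n ih =>
    have hg := gaussOrbit_mem_Ioo h h01 (n + 1)
    exact mul_le_one₀ ih hg.1.le hg.2.le

lemma cfErr_one (h : Irrational θ) : cfErr θ 1 = 1 - gaussDigit θ 0 * θ := by
  have := h.ne_zero
  rw [cfErr, gaussOrbit_succ, cfErr, gaussOrbit]
  field_simp

lemma cfErr_add_two (h : Irrational θ) (n : ℕ) :
    cfErr θ (n + 2) = cfErr θ n - gaussDigit θ (n + 1) * cfErr θ (n + 1) := by
  have := (gaussOrbit_irrational h (n + 1)).ne_zero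
  rw [cfErr, gaussOrbit_succ, cfErr]
  field_simp

lemma cfErr_eq (h : Irrational θ) (n : ℕ) :
    cfErr θ n = (-1) ^ n * (cfDen θ n * θ - cfNum θ n) := by
  induction n using Nat.twoStepInduction with
  | zero => simp [cfErr, cfDen, cfNum]
  | one => rw [cfErr_one h]; simp [cfDen, cfNum]
  | more n ih1 ih2 =>
    rw [cfErr_add_two h, ih1, ih2, cfDen, cfNum]
    push_cast
    ring

lemma cfDen_mul_cfErr (h : Irrational θ) (n : ℕ) :
    cfDen θ (n + 1) * cfErr θ n + cfDen θ n * cfErr θ (n + 1) = 1 := by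
  induction n with
  | zero => rw [cfErr_one h]; simp [cfDen, cfErr]
  | succ n ih =>
    rw [cfErr_add_two h, cfDen]
    push_cast
    linear_combination ih

lemma cfDen_mul_cfNum (θ : ℝ) (n : ℕ) :
    cfDen θ (n + 1) * cfNum θ n - cfDen θ n * cfNum θ (n + 1) = (-1) ^ (n + 1) := by
  induction n with
  | zero => simp [cfDen, cfNum]
  | succ n ih =>
    rw [cfDen, cfNum, pow_succ]
    linear_combination -ih

end Convergents

section Gaps

lemma gapPoints_mem_Icc {θ : ℝ} {N : ℕ} {c : ℝ} (hc : c ∈ gapPoints θ N) :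
    c ∈ Set.Icc (0 : ℝ) 1 := by
  rcases hc with rfl | ⟨k, -, rfl⟩
  · simp
  · exact ⟨Int.fract_nonneg _, (Int.fract_lt_one _).le⟩

/-- If every point of the orbit has another one at circular distance at most `G` on its right,
then no gap exceeds `G`. -/
lemma maxGap_le_of_step {θ G : ℝ} {N : ℕ} (hG : 0 ≤ G)
    (hstep : ∀ i : ℤ, 0 ≤ i → i ≤ N → ∃ j z : ℤ, 0 ≤ j ∧ j ≤ N ∧
      0 < ((j : ℝ) - i) * θ - z ∧ ((j : ℝ) - i) * θ - z ≤ G) :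
    maxGap θ N ≤ G := by
  refine Real.sSup_le ?_ hG
  rintro d ⟨a, ha, b, hb, hab, hcons, rfl⟩
  have hb1 := (gapPoints_mem_Icc hb).2
  rcases ha with rfl | ⟨i, hi, rfl⟩
  · linarith
  obtain ⟨j, z, hj0, hjN, hpos, hle⟩ := hstep i (by positivity) (by exact_mod_cast hi)
  lift j to ℕ using hj0
  simp only [Int.cast_natCast] at hpos hle
  set δ := ((j : ℝ) - i) * θ - z with hδ
  by_cases h1 : Int.fract (i * θ) + δ < 1
  · have hfr : Int.fract ((j : ℝ) * θ) = Int.fract (i * θ) + δ := by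
      rw [Int.fract_eq_iff]
      refine ⟨by linarith [Int.fract_nonneg ((i : ℝ) * θ)], h1, z + ⌊(i : ℝ) * θ⌋, ?_⟩
      push_cast
      rw [Int.fract, hδ]
      ring
    have hmem : Int.fract ((j : ℝ) * θ) ∈ gapPoints θ N :=
      Or.inr ⟨j, by exact_mod_cast hjN, rfl⟩
    have := hcons _ hmem
    rw [hfr] at this
    by_contra! hlt
    exact this ⟨by linarith, by linarith⟩
  · linarith

/-- If `iθ` and `jθ` are at circular distance `G` and no other point of the orbit lies on the arc
from the first to the second, then the largest gap is at least `G`. -/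
lemma le_maxGap_of_isolated {θ G : ℝ} {N i j : ℕ} {z : ℤ} (hi : i ≤ N) (hj : j ≤ N)
    (hG : 0 < G) (hij : ((j : ℝ) - i) * θ - z = G)
    (hiso : ∀ l : ℕ, l ≤ N → ∀ v : ℤ, 0 < ((l : ℝ) - i) * θ - v →
      G ≤ ((l : ℝ) - i) * θ - v) :
    G ≤ maxGap θ N := by
  refine le_csSup (bddAbove_gapSet θ N) ?_
  have hle : Int.fract ((i : ℝ) * θ) + G ≤ 1 := by
    have h1 := Int.fract_lt_one ((i : ℝ) * θ)
    have h2 : (((0 : ℕ) : ℝ) - i) * θ - ((-⌊(i : ℝ) * θ⌋ - 1 : ℤ) : ℝ)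
        = 1 - Int.fract ((i : ℝ) * θ) := by
      push_cast
      rw [Int.fract]
      ring
    have := hiso 0 (Nat.zero_le _) (-⌊(i : ℝ) * θ⌋ - 1)
    rw [h2] at this
    linarith [this (by linarith)]
  refine ⟨_, Or.inr ⟨i, hi, rfl⟩, Int.fract ((i : ℝ) * θ) + G, ?_, by linarith, ?_, by ring⟩
  · rcases hle.eq_or_lt with h | h
    · exact Or.inl h
    · refine Or.inr ⟨j, hj, ?_⟩
      symm
      rw [Int.fract_eq_iff]
      refine ⟨by linarith [Int.fract_nonneg ((i : ℝ) * θ)], h, z + ⌊(i : ℝ) * θ⌋, ?_⟩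
      push_cast
      rw [Int.fract, ← hij]
      ring
  · rintro c (rfl | ⟨l, hl, rfl⟩) ⟨h1, h2⟩
    · linarith
    · have h3 : ((l : ℝ) - i) * θ - ((⌊(l : ℝ) * θ⌋ - ⌊(i : ℝ) * θ⌋ : ℤ) : ℝ)
          = Int.fract ((l : ℝ) * θ) - Int.fract ((i : ℝ) * θ) := by
        push_cast
        rw [Int.fract, Int.fract]
        ring
      have := hiso l hl (⌊(l : ℝ) * θ⌋ - ⌊(i : ℝ) * θ⌋)
      rw [h3] at this
      linarith [this (by linarith)]

variable {θ : ℝ}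

/-- Upper half of the three-gap theorem for `m q_k + q_{k-1} ≤ N`, where `k = n + 1`. -/
lemma maxGap_le (h : Irrational θ) (h01 : θ ∈ Set.Ioo (0 : ℝ) 1) (n : ℕ) {m : ℤ} {N : ℕ}
    (hm1 : 1 ≤ m) (hm : m ≤ gaussDigit θ (n + 1))
    (hN : m * cfDen θ (n + 1) + cfDen θ n ≤ N) :
    maxGap θ N ≤ cfErr θ n - (m - 1) * cfErr θ (n + 1) := by
  have hE := cfErr_pos h h01 (n + 1)
  have hEE : cfErr θ (n + 1) ≤ cfErr θ n - (m - 1) * cfErr θ (n + 1) := by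
    have h2 := cfErr_pos h h01 (n + 2)
    rw [cfErr_add_two h] at h2
    have hm' : (m : ℝ) ≤ gaussDigit θ (n + 1) := by exact_mod_cast hm
    nlinarith
  have hQ := cfDen_pos h h01 (n + 1)
  have hQ' := cfDen_pos h h01 n
  have hnn : 0 ≤ (m - 1) * cfDen θ (n + 1) := mul_nonneg (by linarith) hQ.le
  have e0 := cfErr_eq h n
  have e1 := cfErr_eq h (n + 1)
  refine maxGap_le_of_step (hE.le.trans hEE) fun i hi0 hiN => ?_
  set Q := cfDen θ (n + 1)
  set Q' := cfDen θ n
  set P := cfNum θ (n + 1)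
  set P' := cfNum θ n
  rcases Nat.even_or_odd n with hpar | hpar
  · rw [hpar.neg_one_pow] at e0
    rw [hpar.add_one.neg_one_pow] at e1
    by_cases hc : Q ≤ i
    · refine ⟨i - Q, -P, by linarith, by linarith, ?_⟩
      have : (((i - Q : ℤ) : ℝ) - i) * θ - ((-P : ℤ) : ℝ) = cfErr θ (n + 1) := by
        rw [e1]; push_cast; ring
      rw [this]
      exact ⟨hE, hEE⟩
    · refine ⟨i + Q' + (m - 1) * Q, P' + (m - 1) * P, by linarith, by linarith, ?_⟩
      have : (((i + Q' + (m - 1) * Q : ℤ) : ℝ) - i) * θ - ((P' + (m - 1) * P : ℤ) : ℝ)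
          = cfErr θ n - (m - 1) * cfErr θ (n + 1) := by
        rw [e0, e1]; push_cast; ring
      rw [this]
      exact ⟨hE.trans_le hEE, le_rfl⟩
  · rw [hpar.neg_one_pow] at e0
    rw [hpar.add_one.neg_one_pow] at e1
    by_cases hc : i + Q ≤ N
    · refine ⟨i + Q, P, by linarith, by linarith, ?_⟩
      have : (((i + Q : ℤ) : ℝ) - i) * θ - (P : ℝ) = cfErr θ (n + 1) := by
        rw [e1]; push_cast; ring
      rw [this]
      exact ⟨hE, hEE⟩
    · refine ⟨i - Q' - (m - 1) * Q, -P' - (m - 1) * P, by linarith, by linarith, ?_⟩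
      have : (((i - Q' - (m - 1) * Q : ℤ) : ℝ) - i) * θ - ((-P' - (m - 1) * P : ℤ) : ℝ)
          = cfErr θ n - (m - 1) * cfErr θ (n + 1) := by
        rw [e0, e1]; push_cast; ring
      rw [this]
      exact ⟨hE.trans_le hEE, le_rfl⟩

/-- Lower half of the three-gap theorem for `N = (m + 1) q_k + q_{k-1} - 2`, where `k = n + 1`
is odd. -/
lemma le_maxGap (h : Irrational θ) (h01 : θ ∈ Set.Ioo (0 : ℝ) 1) {n : ℕ} (hn : Even n)
    {m : ℤ} {N : ℕ} (hm1 : 1 ≤ m) (hm : m ≤ gaussDigit θ (n + 1))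
    (hQ2 : 2 ≤ cfDen θ (n + 1))
    (hN : (N : ℤ) = (m + 1) * cfDen θ (n + 1) + cfDen θ n - 2) :
    cfErr θ n - (m - 1) * cfErr θ (n + 1) ≤ maxGap θ N := by
  have hE := cfErr_pos h h01 (n + 1)
  have hE' := cfErr_pos h h01 n
  have hG : 0 < cfErr θ n - (m - 1) * cfErr θ (n + 1) := by
    have h2 := cfErr_pos h h01 (n + 2)
    rw [cfErr_add_two h] at h2
    have hm' : (m : ℝ) ≤ gaussDigit θ (n + 1) := by exact_mod_cast hm
    nlinarith
  have hQ' := cfDen_pos h h01 n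
  have e0 := cfErr_eq h n
  have e1 := cfErr_eq h (n + 1)
  have hdet := cfDen_mul_cfNum θ n
  rw [hn.neg_one_pow] at e0
  rw [hn.add_one.neg_one_pow] at e1 hdet
  set Q := cfDen θ (n + 1)
  set Q' := cfDen θ n
  set P := cfNum θ (n + 1)
  set P' := cfNum θ n
  set E := cfErr θ (n + 1)
  set E' := cfErr θ n
  have hmQ : Q ≤ m * Q := by nlinarith
  obtain ⟨i, hi⟩ : ∃ i : ℕ, (i : ℤ) = Q - 1 := ⟨(Q - 1).toNat, by omega⟩
  obtain ⟨j, hj⟩ : ∃ j : ℕ, (j : ℤ) = m * Q + Q' - 1 := ⟨(m * Q + Q' - 1).toNat, by omega⟩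
  have hiR : (i : ℝ) = Q - 1 := by exact_mod_cast hi
  have hjR : (j : ℝ) = m * Q + Q' - 1 := by exact_mod_cast hj
  refine le_maxGap_of_isolated (i := i) (j := j) (z := P' + (m - 1) * P) ?_ ?_ hG ?_ ?_
  · zify; linarith
  · zify; linarith
  · rw [hiR, hjR, e0, e1]; push_cast; ring
  · intro l hl v hpos
    obtain ⟨u, hu⟩ : ∃ u : ℤ, u = (l : ℤ) - i := ⟨_, rfl⟩
    have huR : ((l : ℝ) - i) = u := by rw [hu]; push_cast; ring
    rw [huR] at hpos ⊢
    obtain ⟨α, hα⟩ : ∃ α : ℤ, α = Q' * v - u * P' := ⟨_, rfl⟩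
    obtain ⟨β, hβ⟩ : ∃ β : ℤ, β = u * P - Q * v := ⟨_, rfl⟩
    have hu' : u = α * Q + β * Q' := by
      rw [hα, hβ]; linear_combination u * hdet
    have hv' : v = α * P + β * P' := by
      rw [hα, hβ]; linear_combination v * hdet
    have hval : (u : ℝ) * θ - v = β * E' - α * E := by
      rw [hu', hv', e0, e1]; push_cast; ring
    rw [hval] at hpos ⊢
    have hlo : -(Q - 1) ≤ u := by rw [hu, hi]; linarith [Int.natCast_nonneg l]
    have hhi : u ≤ m * Q + Q' - 1 := by
      have : (l : ℤ) ≤ N := by exact_mod_cast hl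
      rw [hu, hi]; linarith
    by_contra! hlt
    rcases le_or_gt 1 β with hb | hb
    · have hbR : (1 : ℝ) ≤ β := by exact_mod_cast hb
      have : (m : ℝ) - 1 < α := by
        by_contra! hle
        nlinarith
      have hαm : m ≤ α := by
        have : m - 1 < α := by exact_mod_cast this
        linarith
      nlinarith
    · have hb0 : β ≤ 0 := by linarith
      have hbR : (β : ℝ) ≤ 0 := by exact_mod_cast hb0
      have : (α : ℝ) < 0 := by
        by_contra! hle
        nlinarith
      have hα0 : α ≤ -1 := by
        have : α < 0 := by exact_mod_cast this
        linarith
      nlinarith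

end Gaps

section Bounds

variable {θ : ℝ} {B : ℕ} {x y : ℝ}

/-- Bounds on ratios of consecutive denominators, where `x = [0; 1, B, 1, B, …]` and
`y = [0; B, 1, B, 1, …]`. -/
lemma cfDen_ratio_bounds (h : Irrational θ) (h01 : θ ∈ Set.Ioo (0 : ℝ) 1)
    (hB : ∀ n, gaussDigit θ n ≤ B) (hx0 : 0 < x) (hy0 : 0 < y) (hxy : x * (1 + y) = 1)
    (hyx : y * (B + x) = 1) (n : ℕ) :
    (cfDen θ n : ℝ) ≤ x * cfDen θ (n + 1) + 1 ∧ y * cfDen θ (n + 1) - 1 ≤ cfDen θ n := by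
  have hx1 : x ≤ 1 := by nlinarith
  have hBR : ∀ n, (gaussDigit θ n : ℝ) ≤ B := fun n => by exact_mod_cast hB n
  have hb1 : ∀ n, (1 : ℝ) ≤ gaussDigit θ n := fun n => by
    exact_mod_cast one_le_gaussDigit h h01 n
  induction n with
  | zero =>
    have h1 := hBR 0
    have h2 := hb1 0
    simp only [cfDen, Int.cast_one]
    constructor <;> nlinarith
  | succ n ih =>
    have hQ : (0 : ℝ) < cfDen θ (n + 1) := by exact_mod_cast cfDen_pos h h01 (n + 1)
    have hlo := mul_le_mul_of_nonneg_right (hb1 (n + 1)) hQ.le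
    have hhi := mul_le_mul_of_nonneg_right (hBR (n + 1)) hQ.le
    obtain ⟨ih1, ih2⟩ := ih
    rw [cfDen]
    push_cast
    generalize (cfDen θ (n + 1) : ℝ) = Q at *
    generalize (cfDen θ n : ℝ) = Q' at *
    generalize (gaussDigit θ (n + 1) : ℝ) * Q = R at *
    have hy1 : y ≤ 1 := by
      by_contra! hy1
      have hB1 : (1 : ℝ) ≤ B := (hb1 0).trans (hBR 0)
      nlinarith
    constructor
    · have : x * ((1 + y) * Q - 1) ≤ x * (R + Q') :=
        mul_le_mul_of_nonneg_left (by linarith) hx0.le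
      have h3 : x * ((1 + y) * Q - 1) = Q - x := by linear_combination Q * hxy
      linarith
    · have : y * (R + Q') ≤ y * ((B + x) * Q + 1) :=
        mul_le_mul_of_nonneg_left (by linarith) hy0.le
      have h3 : y * ((B + x) * Q + 1) = Q + y := by linear_combination Q * hyx
      linarith

lemma cfErr_succ_le (h : Irrational θ) (h01 : θ ∈ Set.Ioo (0 : ℝ) 1)
    (hB : ∀ n, gaussDigit θ n ≤ B) (hx0 : 0 < x) (hy0 : 0 < y) (hxy : x * (1 + y) = 1)
    (hyx : y * (B + x) = 1) (n : ℕ) : cfErr θ (n + 1) ≤ x * cfErr θ n := by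
  have hstep : ∀ n, cfErr θ (n + 1) - x * cfErr θ n
      ≤ x * y * (cfErr θ (n + 3) - x * cfErr θ (n + 2)) := fun n => by
    have e1 := cfErr_add_two h n
    have e2 := cfErr_add_two h (n + 1)
    have p1 := cfErr_pos h h01 (n + 1)
    have p2 := cfErr_pos h h01 (n + 2)
    have hlo : (1 : ℝ) * cfErr θ (n + 1) ≤ gaussDigit θ (n + 1) * cfErr θ (n + 1) :=
      mul_le_mul_of_nonneg_right (by exact_mod_cast one_le_gaussDigit h h01 _) p1.le
    have hhi : gaussDigit θ (n + 2) * cfErr θ (n + 2) ≤ (B : ℝ) * cfErr θ (n + 2) :=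
      mul_le_mul_of_nonneg_right (by exact_mod_cast hB _) p2.le
    have s1 : x * (cfErr θ (n + 1) + cfErr θ (n + 2)) ≤ x * cfErr θ n :=
      mul_le_mul_of_nonneg_left (by linarith) hx0.le
    have s2 : x * (y * cfErr θ (n + 1)) ≤
        x * (y * (B * cfErr θ (n + 2) + cfErr θ (n + 3))) := by
      refine mul_le_mul_of_nonneg_left (mul_le_mul_of_nonneg_left ?_ hy0.le) hx0.le
      rw [show n + 3 = n + 1 + 2 from rfl, e2]
      have : gaussDigit θ (n + 1 + 1) = gaussDigit θ (n + 2) := rfl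
      rw [this, show n + 1 + 1 = n + 2 from rfl]
      linarith
    have e3 : x * (cfErr θ (n + 1) + cfErr θ (n + 2)) =
        cfErr θ (n + 1) - x * (y * cfErr θ (n + 1)) + x * cfErr θ (n + 2) := by
      linear_combination cfErr θ (n + 1) * hxy
    have e4 : x * (y * (B * cfErr θ (n + 2) + cfErr θ (n + 3))) =
        x * cfErr θ (n + 2) - x * y * x * cfErr θ (n + 2) + x * y * cfErr θ (n + 3) := by
      linear_combination x * cfErr θ (n + 2) * hyx
    linarith
  have hr0 : 0 < x * y := by positivity
  have hr1 : x * y < 1 := by linarith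
  have hpow : ∀ j n, cfErr θ (n + 1) - x * cfErr θ n ≤ (x * y) ^ j := fun j => by
    induction j with
    | zero =>
      intro n
      have := cfErr_le_one h h01 (n + 1)
      have := mul_pos hx0 (cfErr_pos h h01 n)
      simp only [pow_zero]
      linarith
    | succ j ih =>
      intro n
      rw [pow_succ']
      exact (hstep n).trans (mul_le_mul_of_nonneg_left (ih (n + 2)) hr0.le)
  have := ge_of_tendsto' (tendsto_pow_atTop_nhds_zero_of_lt_one hr0.le hr1) fun j => hpow j n
  linarith

end Bounds

/-- If `E' ≤ (2s - x) E`, `Q' - 1 ≤ x Q` and `Q E' + Q' E = 1`, then optimizing over `m` by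
AM-GM bounds `((m + 1) Q + Q' - 1)(E' - (m - 1) E)`. -/
lemma gap_product_le_s7 {Q Q' E E' m s x : ℝ} (hQ : 0 < Q) (hQ' : 1 ≤ Q') (hE : 0 < E)
    (hs : 1 ≤ s) (hdet : Q * E' + Q' * E = 1) (h2 : 2 * E ≤ E') (hE' : E' ≤ (2 * s - x) * E)
    (hQx : Q' - 1 ≤ x * Q) :
    ((m + 1) * Q + Q' - 1) * (E' - (m - 1) * E) ≤ (s + 1) ^ 2 / (2 * s) := by
  obtain ⟨t, rfl⟩ : ∃ t, E' = t * E := ⟨E' / E, by field_simp⟩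
  obtain ⟨r, hr⟩ : ∃ r, Q' = r * Q + 1 := ⟨(Q' - 1) / Q, by field_simp; ring⟩
  have ht2 : 2 ≤ t := le_of_mul_le_mul_right h2 hE
  have htx : t ≤ 2 * s - x := le_of_mul_le_mul_right hE' hE
  have hr0 : 0 ≤ r := by
    by_contra! hneg
    nlinarith
  have hrx : r ≤ x := by
    refine le_of_mul_le_mul_right ?_ hQ
    linarith
  subst hr
  have hQE : Q * E * (t + r) ≤ 1 := by nlinarith
  have hu : (t + r + 2) ^ 2 / 4 ≤ (s + 1) ^ 2 / (2 * s) * (t + r) := by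
    rw [div_mul_eq_mul_div, div_le_div_iff₀ (by norm_num) (by positivity)]
    have : (t + r - 2 * s) * (s * (t + r) - 2) ≤ 0 :=
      mul_nonpos_of_nonpos_of_nonneg (by linarith) (by nlinarith)
    nlinarith
  calc ((m + 1) * Q + (r * Q + 1) - 1) * (t * E - (m - 1) * E)
      = Q * E * ((m + 1 + r) * (t - m + 1)) := by ring
    _ ≤ Q * E * ((t + r + 2) ^ 2 / 4) := by
        gcongr
        nlinarith [sq_nonneg ((m + 1 + r) - (t - m + 1))]
    _ ≤ Q * E * ((s + 1) ^ 2 / (2 * s) * (t + r)) := by gcongr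
    _ = (s + 1) ^ 2 / (2 * s) * (Q * E * (t + r)) := by ring
    _ ≤ (s + 1) ^ 2 / (2 * s) := mul_le_of_le_one_right (by positivity) hQE

lemma natCast_mul_maxGap_le {θ : ℝ} {a : ℕ} {x y s : ℝ} (h : Irrational θ)
    (h01 : θ ∈ Set.Ioo (0 : ℝ) 1) (hB : ∀ n, gaussDigit θ n ≤ (2 * a : ℕ)) (hx0 : 0 < x)
    (hy0 : 0 < y) (hxy : x * (1 + y) = 1) (hyx : y * ((2 * a : ℕ) + x) = 1)
    (hs : s = a + x) (hs1 : 1 ≤ s) {n N : ℕ}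
    (hN1 : cfDen θ (n + 1) + cfDen θ n ≤ N) (hN2 : (N : ℤ) < cfDen θ (n + 2)) :
    N * maxGap θ N ≤ (s + 1) ^ 2 / (2 * s) := by
  have hQ := cfDen_pos h h01 (n + 1)
  have hQ' := cfDen_pos h h01 n
  have hE := cfErr_pos h h01 (n + 1)
  have hE2 := cfErr_pos h h01 (n + 2)
  obtain ⟨m, hm⟩ : ∃ m, m = ((N : ℤ) - cfDen θ n) / cfDen θ (n + 1) := ⟨_, rfl⟩
  have hm1 : 1 ≤ m := by rw [hm, Int.le_ediv_iff_mul_le hQ]; linarith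
  have hmA : m < gaussDigit θ (n + 1) := by
    rw [hm, Int.ediv_lt_iff_lt_mul hQ]
    rw [cfDen] at hN2
    linarith
  have hmlo : m * cfDen θ (n + 1) + cfDen θ n ≤ N := by
    have := Int.ediv_mul_le ((N : ℤ) - cfDen θ n) hQ.ne'
    rw [← hm] at this
    linarith
  have hmhi : (N : ℤ) + 1 ≤ (m + 1) * cfDen θ (n + 1) + cfDen θ n := by
    have := Int.lt_ediv_add_one_mul_self ((N : ℤ) - cfDen θ n) hQ
    rw [← hm] at this
    linarith
  have hmhiR : (N : ℝ) ≤ (m + 1) * cfDen θ (n + 1) + cfDen θ n - 1 := by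
    have : (N : ℝ) + 1 ≤ (m + 1) * cfDen θ (n + 1) + cfDen θ n := by exact_mod_cast hmhi
    linarith
  have hgap := maxGap_le h h01 n hm1 hmA.le hmlo
  have hx := cfErr_succ_le h h01 hB hx0 hy0 hxy hyx (n + 1)
  have he := cfErr_add_two h n
  have hA2 : (2 : ℝ) ≤ gaussDigit θ (n + 1) := by
    have : 2 ≤ gaussDigit θ (n + 1) := by linarith
    exact_mod_cast this
  have hAB : (gaussDigit θ (n + 1) : ℝ) ≤ 2 * a := by exact_mod_cast hB (n + 1)
  have hAm : (m : ℝ) ≤ gaussDigit θ (n + 1) := by exact_mod_cast hmA.le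
  have hG0 : 0 ≤ cfErr θ n - (m - 1) * cfErr θ (n + 1) := by nlinarith
  calc (N : ℝ) * maxGap θ N
      ≤ N * (cfErr θ n - (m - 1) * cfErr θ (n + 1)) := by gcongr
    _ ≤ ((m + 1) * cfDen θ (n + 1) + cfDen θ n - 1) *
          (cfErr θ n - (m - 1) * cfErr θ (n + 1)) := by gcongr
    _ ≤ (s + 1) ^ 2 / (2 * s) := by
        refine gap_product_le_s7 (x := x) (by exact_mod_cast hQ) (by exact_mod_cast hQ') hE hs1
          (cfDen_mul_cfErr h n) ?_ ?_ ?_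
        · nlinarith
        · rw [hs]
          nlinarith
        · linarith [(cfDen_ratio_bounds h h01 hB hx0 hy0 hxy hyx n).1]

section Extremal

variable {B : ℕ} {x y : ℝ}

lemma gaussOrbit_extremal (hx0 : 0 < x) (hx1 : x < 1) (hy0 : 0 < y) (hy1 : y < 1)
    (hxy : x * (1 + y) = 1) (hyx : y * (B + x) = 1) (j : ℕ) :
    gaussOrbit x (2 * j) = x ∧ gaussOrbit x (2 * j + 1) = y := by
  have h1 : Int.fract x⁻¹ = y := by
    rw [inv_eq_of_mul_eq_one_right hxy, Int.fract_one_add, Int.fract_eq_self.mpr ⟨hy0.le, hy1⟩]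
  have h2 : Int.fract y⁻¹ = x := by
    rw [inv_eq_of_mul_eq_one_right hyx, Int.fract_natCast_add,
      Int.fract_eq_self.mpr ⟨hx0.le, hx1⟩]
  induction j with
  | zero => exact ⟨rfl, h1⟩
  | succ j ih =>
    have h3 : gaussOrbit x (2 * (j + 1)) = x := by
      rw [show 2 * (j + 1) = 2 * j + 1 + 1 by ring, gaussOrbit, ih.2, h2]
    exact ⟨h3, by rw [gaussOrbit, h3, h1]⟩

lemma gaussDigit_extremal (hx0 : 0 < x) (hx1 : x < 1) (hy0 : 0 < y) (hy1 : y < 1)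
    (hxy : x * (1 + y) = 1) (hyx : y * (B + x) = 1) (j : ℕ) :
    gaussDigit x (2 * j) = 1 ∧ gaussDigit x (2 * j + 1) = B := by
  obtain ⟨h1, h2⟩ := gaussOrbit_extremal hx0 hx1 hy0 hy1 hxy hyx j
  constructor
  · rw [gaussDigit, h1, inv_eq_of_mul_eq_one_right hxy, Int.floor_eq_iff]
    push_cast
    constructor <;> linarith
  · rw [gaussDigit, h2, inv_eq_of_mul_eq_one_right hyx, Int.floor_eq_iff]
    push_cast
    constructor <;> linarith

lemma cfDen_extremal_le (hx0 : 0 < x) (hx1 : x < 1) (hy0 : 0 < y) (hy1 : y < 1)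
    (hxy : x * (1 + y) = 1) (hyx : y * (B + x) = 1) (j : ℕ) :
    x * cfDen x (2 * j + 1) ≤ cfDen x (2 * j) := by
  have hd := gaussDigit_extremal hx0 hx1 hy0 hy1 hxy hyx
  induction j with
  | zero =>
    have := (hd 0).1
    simp only [mul_zero] at this
    simp [cfDen, this, hx1.le]
  | succ j ih =>
    have e1 : cfDen x (2 * (j + 1)) = B * cfDen x (2 * j + 1) + cfDen x (2 * j) := by
      rw [← (hd j).2]; rfl
    have e2 : cfDen x (2 * (j + 1) + 1) = cfDen x (2 * (j + 1)) + cfDen x (2 * j + 1) := by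
      rw [← one_mul (cfDen x (2 * (j + 1))), ← (hd (j + 1)).1]; rfl
    rw [e2, e1]
    push_cast
    have hkey : (B * cfDen x (2 * j + 1) + cfDen x (2 * j) : ℝ)
        - x * (B * cfDen x (2 * j + 1) + cfDen x (2 * j) + cfDen x (2 * j + 1))
        = x * y * (cfDen x (2 * j) - x * cfDen x (2 * j + 1)) := by
      linear_combination (-(B * cfDen x (2 * j + 1) + cfDen x (2 * j) : ℝ)) * hxy
        + x * cfDen x (2 * j + 1) * hyx
    have : 0 ≤ x * y * (cfDen x (2 * j) - x * cfDen x (2 * j + 1)) := by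
      have := sub_nonneg.mpr ih
      positivity
    linarith

end Extremal

/-- The quotient `((s + 1) Q - 2)(s + 1) / (2 s Q + 1)` differs from its limit as `Q → ∞` by at
most a multiple of `1 / Q`. -/
lemma limit_sub_le {Q s c : ℝ} (hs : 1 ≤ s) (hc : 0 < c) (hcQ : c ≤ Q) :
    (s + 1) ^ 2 / (2 * s) - (s + 1) * (5 * s + 1) / c
      ≤ ((s + 1) * Q - 2) * (s + 1) / (2 * s * Q + 1) := by
  have hQ : 0 < Q := hc.trans_le hcQ
  have h1 : (s + 1) ^ 2 / (2 * s) - ((s + 1) * Q - 2) * (s + 1) / (2 * s * Q + 1)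
      = (s + 1) * (5 * s + 1) / (2 * s * (2 * s * Q + 1)) := by
    have : 2 * s * Q + 1 ≠ 0 := by positivity
    field_simp
    ring
  have h2 : (s + 1) * (5 * s + 1) / (2 * s * (2 * s * Q + 1)) ≤ (s + 1) * (5 * s + 1) / c := by
    gcongr
    nlinarith [mul_pos (by linarith : 0 < s) hQ]
  linarith

/-- The number `x = [0; 1, 2a, 1, 2a, …]` comes arbitrarily close to the extremal constant. -/
lemma exists_le_natCast_mul_maxGap {a : ℕ} (ha : 1 ≤ a) {x y s : ℝ} (h : Irrational x)
    (hx0 : 0 < x) (hx1 : x < 1) (hy0 : 0 < y) (hy1 : y < 1) (hxy : x * (1 + y) = 1)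
    (hyx : y * ((2 * a : ℕ) + x) = 1) (hs : s = a + x) (j : ℕ) :
    ∃ N : ℕ, cfDen x (2 * (j + 1) + 1) + cfDen x (2 * (j + 1)) ≤ N ∧
      (N : ℤ) < cfDen x (2 * (j + 1) + 2) ∧
      (s + 1) ^ 2 / (2 * s) - (s + 1) * (5 * s + 1) / (j + 1) ≤ N * maxGap x N := by
  have h01 : x ∈ Set.Ioo (0 : ℝ) 1 := ⟨hx0, hx1⟩
  have haR : (1 : ℝ) ≤ a := by exact_mod_cast ha
  have haZ : (1 : ℤ) ≤ a := by exact_mod_cast ha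
  have hd := gaussDigit_extremal hx0 hx1 hy0 hy1 hxy hyx
  have hB : ∀ n, gaussDigit x n ≤ (2 * a : ℕ) := fun n => by
    obtain ⟨i, rfl | rfl⟩ := Nat.even_or_odd' n
    · rw [(hd i).1]; push_cast; linarith
    · rw [(hd i).2]
  have hlow := cfDen_extremal_le hx0 hx1 hy0 hy1 hxy hyx (j + 1)
  have hQj := succ_le_cfDen_succ h h01 (2 * (j + 1))
  have hup := (cfDen_ratio_bounds h h01 hB hx0 hy0 hxy hyx (2 * (j + 1))).1
  have hQ' := cfDen_pos h h01 (2 * (j + 1))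
  have hE := cfErr_pos h h01 (2 * (j + 1) + 1)
  have hE' : cfErr x (2 * (j + 1)) = (2 * a + x) * cfErr x (2 * (j + 1) + 1) := by
    rw [cfErr, (gaussOrbit_extremal hx0 hx1 hy0 hy1 hxy hyx (j + 1)).2]
    push_cast at hyx
    linear_combination (-cfErr x (2 * (j + 1))) * hyx
  have hdet := cfDen_mul_cfErr h (2 * (j + 1))
  have hdig : gaussDigit x (2 * (j + 1) + 1) = 2 * a := by rw [(hd (j + 1)).2]; push_cast; ring
  have hgap := fun N : ℕ => le_maxGap h h01 (even_two_mul (j + 1)) (m := a) (N := N) haZ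
    (by rw [hdig]; linarith) (by push_cast at hQj; linarith)
  rw [cfDen, hdig]
  push_cast at hQj
  rw [hE'] at hdet
  have hQjR : (j : ℝ) + 1 ≤ cfDen x (2 * (j + 1) + 1) := by
    have : (j : ℤ) + 1 ≤ cfDen x (2 * (j + 1) + 1) := by linarith
    exact_mod_cast this
  simp only [hE'] at hgap
  set Q := cfDen x (2 * (j + 1) + 1)
  set Q' := cfDen x (2 * (j + 1))
  set E := cfErr x (2 * (j + 1) + 1)
  have haQ : Q ≤ a * Q := by nlinarith
  obtain ⟨N, hN⟩ : ∃ N : ℕ, (N : ℤ) = (a + 1) * Q + Q' - 2 :=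
    ⟨((a + 1) * Q + Q' - 2).toNat, by rw [Int.toNat_of_nonneg]; nlinarith⟩
  refine ⟨N, by nlinarith, by nlinarith, ?_⟩
  have hNR : (N : ℝ) = (a + 1) * Q + Q' - 2 := by exact_mod_cast hN
  have hj0 : (0 : ℝ) < j + 1 := by positivity
  have hQ0 : (0 : ℝ) < Q := hj0.trans_le hQjR
  have hden : 0 < (2 * a + x) * Q + Q' := by
    have : (0 : ℝ) < Q' := by exact_mod_cast hQ'
    positivity
  have hEeq : E = 1 / ((2 * a + x) * Q + Q') := by
    rw [eq_div_iff hden.ne']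
    linarith
  have hN0 : (0 : ℝ) ≤ N := N.cast_nonneg
  calc (s + 1) ^ 2 / (2 * s) - (s + 1) * (5 * s + 1) / (j + 1)
      ≤ ((s + 1) * Q - 2) * (s + 1) / (2 * s * Q + 1) :=
        limit_sub_le (by linarith) hj0 hQjR
    _ ≤ N * (s + 1) / ((2 * a + x) * Q + Q') := by
        have hs0 : 0 ≤ s + 1 := by linarith
        refine div_le_div₀ (by positivity) ?_ hden ?_
        · refine mul_le_mul_of_nonneg_right ?_ hs0
          rw [hNR, hs]
          linarith
        · rw [hs]
          linarith
    _ = N * ((2 * a + x) * E - (((a : ℤ) : ℝ) - 1) * E) := by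
        rw [hEeq, hs]
        push_cast
        ring
    _ ≤ N * maxGap x N := mul_le_mul_of_nonneg_left (hgap N hN) hN0

/-- **Case 2.1 of the proof of Theorem 4.**  For even `B = 2a` (`a ≥ 1`), the supremum of
`N·H(θ,N)` over `θ ∈ S_B`, `k ≥ 1` and integers `N` with `q_k + q_{k-1} ≤ N < q_{k+1}`
equals `1 + (a+1)²/(2√(a²+2a))`. -/
theorem sup_case2_even (a : ℕ) (ha : 1 ≤ a) :
    sSup {x : ℝ | ∃ θ ∈ SB (2 * a), ∃ k : ℕ, 1 ≤ k ∧ ∃ N : ℕ,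
        ((GenContFract.of θ).dens k + (GenContFract.of θ).dens (k - 1) ≤ (N : ℝ) ∧
          (N : ℝ) < (GenContFract.of θ).dens (k + 1)) ∧
        x = (N : ℝ) * maxGap θ N} =
      1 + ((a : ℝ) + 1) ^ 2 / (2 * Real.sqrt ((a : ℝ) ^ 2 + 2 * a)) := by
  have haR : (1 : ℝ) ≤ a := by exact_mod_cast ha
  obtain ⟨s, hs⟩ : ∃ s, s = √((a : ℝ) ^ 2 + 2 * a) := ⟨_, rfl⟩
  have hsq : s ^ 2 = (a : ℝ) ^ 2 + 2 * a := by rw [hs]; exact Real.sq_sqrt (by positivity)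
  have hs0 : 0 ≤ s := by rw [hs]; positivity
  have hsa : (a : ℝ) < s := lt_of_pow_lt_pow_left₀ 2 hs0 (by linarith)
  have hsa1 : s < a + 1 := lt_of_pow_lt_pow_left₀ 2 (by positivity) (by linarith)
  obtain ⟨x, hx⟩ : ∃ x, x = s - a := ⟨_, rfl⟩
  obtain ⟨y, hy⟩ : ∃ y, y = x / (2 * a) := ⟨_, rfl⟩
  have hx0 : 0 < x := by linarith
  have hx1 : x < 1 := by linarith
  have hy0 : 0 < y := by rw [hy]; positivity
  have hy1 : y < 1 := by rw [hy, div_lt_one (by positivity)]; linarith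
  have hxx : x * (2 * a + x) = 2 * a := by rw [hx]; linear_combination hsq
  have hyx : y * ((2 * a : ℕ) + x) = 1 := by
    rw [hy]; push_cast; field_simp; linarith
  have hxy : x * (1 + y) = 1 := by
    rw [hy]; field_simp; linarith
  have hxirr : Irrational x := by
    have h1 : Irrational s := by
      rw [hs, show (a : ℝ) ^ 2 + 2 * a = ((a ^ 2 + 2 * a : ℕ) : ℝ) by push_cast; ring,
        irrational_sqrt_natCast_iff]
      rintro ⟨r, hr⟩
      have h1 : a < r := by nlinarith
      have h2 : r < a + 1 := by nlinarith
      omega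
    rw [hx]
    exact h1.sub_natCast a
  have hsx : s = a + x := by linarith
  have hs1 : 1 ≤ s := by linarith
  have hx01 : x ∈ Set.Ioo (0 : ℝ) 1 := ⟨hx0, hx1⟩
  have hval : 1 + ((a : ℝ) + 1) ^ 2 / (2 * √((a : ℝ) ^ 2 + 2 * a)) = (s + 1) ^ 2 / (2 * s) := by
    rw [← hs]
    field_simp
    linear_combination -hsq
  rw [hval]
  have hxSB : x ∈ SB (2 * a) := by
    refine ⟨hxirr, hx01, (partQuotBounded_iff hxirr hx01 _).mpr fun n => ?_⟩
    have hd := gaussDigit_extremal hx0 hx1 hy0 hy1 hxy hyx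
    obtain ⟨i, rfl | rfl⟩ := Nat.even_or_odd' n
    · rw [(hd i).1]; exact_mod_cast (by linarith : 1 ≤ 2 * a)
    · rw [(hd i).2]
  refine IsLUB.csSup_eq ⟨?_, ?_⟩ ?_
  · rintro _ ⟨θ, ⟨hirr, h01, hB⟩, k, hk, N, ⟨hN1, hN2⟩, rfl⟩
    obtain ⟨n, rfl⟩ : ∃ n, k = n + 1 := ⟨k - 1, by omega⟩
    simp only [of_dens_eq_cfDen hirr h01, Nat.add_sub_cancel] at hN1 hN2
    exact natCast_mul_maxGap_le hirr h01 ((partQuotBounded_iff hirr h01 _).mp hB) hx0 hy0 hxy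
      hyx hsx hs1 (by exact_mod_cast hN1) (by exact_mod_cast hN2)
  · intro M hM
    have hlim : Filter.Tendsto
        (fun j : ℕ => (s + 1) ^ 2 / (2 * s) - (s + 1) * (5 * s + 1) / ((j : ℝ) + 1))
        Filter.atTop (nhds ((s + 1) ^ 2 / (2 * s) - 0)) := by
      refine tendsto_const_nhds.sub ?_
      exact tendsto_const_nhds.div_atTop
        (Filter.tendsto_atTop_add_const_right _ _ tendsto_natCast_atTop_atTop)
    rw [sub_zero] at hlim
    refine le_of_tendsto' hlim fun j => ?_
    obtain ⟨N, hN1, hN2, hle⟩ :=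
      exists_le_natCast_mul_maxGap ha hxirr hx0 hx1 hy0 hy1 hxy hyx hsx j
    refine hle.trans (hM ⟨x, hxSB, 2 * (j + 1) + 1, by omega, N, ⟨?_, ?_⟩, rfl⟩)
    · simp only [of_dens_eq_cfDen hxirr hx01, Nat.add_sub_cancel]
      exact_mod_cast hN1
    · rw [of_dens_eq_cfDen hxirr hx01]
      exact_mod_cast hN2
  · obtain ⟨N, hN1, hN2, -⟩ :=
      exists_le_natCast_mul_maxGap ha hxirr hx0 hx1 hy0 hy1 hxy hyx hsx 0
    refine ⟨_, x, hxSB, 2 * (0 + 1) + 1, by omega, N, ⟨?_, ?_⟩, rfl⟩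
    · simp only [of_dens_eq_cfDen hxirr hx01, Nat.add_sub_cancel]
      exact_mod_cast hN1
    · rw [of_dens_eq_cfDen hxirr hx01]
      exact_mod_cast hN2
end
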